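/- Assume the state-evolution fixed-point setup: σ : (0, ∞) → (0, ∞) is differentiable and satisfies σ(β)² = σ_w² + (1/δ)·E[(η(X + σ(β)Z; β·σ(β)) − X)²] for every β > 0. Then the function β ↦ σ(β)² is quasi-convex on (0, ∞): its derivative has at most one sign change, from negative to positive; equivalently, for all 0 < β₁ < β₂ < β₃, σ(β₂)² ≤ max(σ(β₁)², σ(β₃)²). Consequently the asymptotic mean squared error β ↦ E[(η(X + σ(β)Z; β·σ(β)) − X)²] = δ·(σ(β)² − σ_w²) is quasi-convex in β. Furthermore, if P(X ≠ 0) > 0 then β ↦ σ(β)² attains a global minimum on (0, ∞) (it is bowl-shaped). -/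

import Mathlib

open MeasureTheory

/-- Standard Gaussian density `φ(z) = e^{-z²/2}/√(2π)`. -/
noncomputable def gaussPDF (z : ℝ) : ℝ := Real.exp (-z ^ 2 / 2) / Real.sqrt (2 * Real.pi)

/-- Soft-thresholding function `η(x; τ) = sign(x)·max(|x| − τ, 0)`. -/
noncomputable def softThr (x τ : ℝ) : ℝ := Real.sign x * max (|x| - τ) 0

/-- Soft-thresholding risk `r(τ; G) = E_{μ∼G, Z∼N(0,1)}[(η(μ + Z; τ) − μ)²]`. -/
noncomputable def stRisk (G : Measure ℝ) (τ : ℝ) : ℝ :=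
  ∫ m, (∫ z, (softThr (m + z) τ - m) ^ 2 * gaussPDF z) ∂G

open Set Filter Topology

lemma gp_pos (z : ℝ) : 0 < gaussPDF z := by unfold gaussPDF; positivity

lemma gp_neg (z : ℝ) : gaussPDF (-z) = gaussPDF z := by unfold gaussPDF; simp

lemma gp_cont : Continuous gaussPDF := by unfold gaussPDF; fun_prop

lemma gp_eq (z : ℝ) : gaussPDF z = Real.exp (-(1/2) * z ^ 2) / Real.sqrt (2 * Real.pi) := by
  unfold gaussPDF; congr 2; ring

lemma gp_deriv (z : ℝ) : HasDerivAt gaussPDF (-z * gaussPDF z) z := by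
  unfold gaussPDF
  have h : HasDerivAt (fun z : ℝ => -z ^ 2 / 2) (-z) z := by
    have := ((hasDerivAt_pow 2 z).neg).div_const 2
    exact this.congr_deriv (by simp; ring)
  exact ((h.exp).div_const (Real.sqrt (2 * Real.pi))).congr_deriv (by ring)

lemma gp_pow_int (k : ℕ) : Integrable (fun z => z ^ k * gaussPDF z) := by
  have h := integrable_rpow_mul_exp_neg_mul_sq (b := 1/2) (by norm_num) (s := (k:ℝ))
    (by have : (0:ℝ) ≤ k := by positivity
        linarith)
  have := h.div_const (Real.sqrt (2 * Real.pi))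
  refine this.congr (ae_of_all _ fun z => ?_)
  simp only [gp_eq, Real.rpow_natCast]
  ring

lemma gp_int : Integrable gaussPDF := by simpa using gp_pow_int 0

lemma gp_one : ∫ z, gaussPDF z = 1 := by
  have : ∀ z, gaussPDF z = Real.exp (-(1/2) * z ^ 2) / Real.sqrt (2 * Real.pi) := gp_eq
  simp_rw [this]
  rw [integral_div, integral_gaussian]
  rw [show Real.pi / (1/2) = 2 * Real.pi by ring]
  exact div_self (by positivity)

lemma gp_pow_tendsto (k : ℕ) : Tendsto (fun z => z ^ k * gaussPDF z) atTop (𝓝 0) := by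
  have h := rpow_mul_exp_neg_mul_sq_isLittleO_exp_neg (b := 1/2) (by norm_num) (k:ℝ)
  have h2 : Tendsto (fun x : ℝ => Real.exp (-(1/2) * x)) atTop (𝓝 0) := by
    apply Real.tendsto_exp_atBot.comp
    exact tendsto_id.const_mul_atTop_of_neg (by norm_num)
  have h3 := (h.trans_tendsto h2).div_const (Real.sqrt (2 * Real.pi))
  rw [zero_div] at h3
  refine h3.congr fun z => ?_
  simp only [gp_eq, Real.rpow_natCast]
  ring

noncomputable def gQ (a : ℝ) : ℝ := ∫ z in Ioi a, gaussPDF z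

lemma gQ_eq (a : ℝ) : gQ a = gQ 0 - ∫ z in (0:ℝ)..a, gaussPDF z := by
  have := intervalIntegral.integral_interval_add_Ioi (a := 0) (b := a) (f := gaussPDF) (μ := volume)
    gp_int.integrableOn gp_int.integrableOn
  unfold gQ
  linarith

lemma gQ_deriv (a : ℝ) : HasDerivAt gQ (-gaussPDF a) a := by
  have h : gQ = fun a => gQ 0 - ∫ z in (0:ℝ)..a, gaussPDF z := funext gQ_eq
  rw [h]
  exact (intervalIntegral.integral_hasDerivAt_right (gp_int.intervalIntegrable)
    gp_cont.stronglyMeasurable.stronglyMeasurableAtFilter gp_cont.continuousAt).const_sub _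

lemma gQ_nonneg (a : ℝ) : 0 ≤ gQ a := setIntegral_nonneg measurableSet_Ioi fun z _ => (gp_pos z).le

lemma gQ_anti : Antitone gQ :=
  antitone_of_deriv_nonpos (fun a => (gQ_deriv a).differentiableAt)
    (fun a => by rw [(gQ_deriv a).deriv]; linarith [gp_pos a])

lemma gQ_add (a : ℝ) : gQ a + gQ (-a) = 1 := by
  have h : gQ (-a) = ∫ z in Iic a, gaussPDF z := by
    unfold gQ
    rw [← integral_comp_neg_Iic]
    simp_rw [gp_neg]
  rw [h, ← gp_one, add_comm]
  exact intervalIntegral.integral_Iic_add_Ioi gp_int.integrableOn gp_int.integrableOn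

lemma gQ_tendsto : Tendsto gQ atTop (𝓝 0) := by
  have h : Tendsto (fun a => ∫ z in (0:ℝ)..a, gaussPDF z) atTop (𝓝 (gQ 0)) :=
    intervalIntegral_tendsto_integral_Ioi 0 gp_int.integrableOn tendsto_id
  have := h.const_sub (gQ 0)
  rw [sub_self] at this
  exact this.congr fun a => (gQ_eq a).symm

noncomputable def gJ1 (a : ℝ) : ℝ := gaussPDF a - a * gQ a
noncomputable def gJ2 (a : ℝ) : ℝ := (1 + a ^ 2) * gQ a - a * gaussPDF a

lemma gJ1_deriv (a : ℝ) : HasDerivAt gJ1 (-gQ a) a := by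
  have := (gp_deriv a).sub ((hasDerivAt_id a).mul (gQ_deriv a))
  exact this.congr_deriv (by simp)

lemma gJ2_deriv (a : ℝ) : HasDerivAt gJ2 (-2 * gJ1 a) a := by
  have := ((((hasDerivAt_pow 2 a).const_add 1)).mul (gQ_deriv a)).sub
    ((hasDerivAt_id a).mul (gp_deriv a))
  exact this.congr_deriv (by simp [gJ1]; ring)

lemma gJ_int (a : ℝ) (k : ℕ) : Integrable (fun z => (z - a) ^ k * gaussPDF z) := by
  have : (fun z => (z - a) ^ k * gaussPDF z) = fun z => ∑ i ∈ Finset.range (k+1),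
      ((-a) ^ (k - i) * (k.choose i)) * (z ^ i * gaussPDF z) := by
    funext z
    rw [sub_eq_add_neg, add_pow, Finset.sum_mul]
    exact Finset.sum_congr rfl fun i _ => by ring
  rw [this]
  exact integrable_finsetSum _ fun i _ => (gp_pow_int i).const_mul _

lemma gJ1_eq (a : ℝ) : ∫ z in Ioi a, (z - a) ^ 1 * gaussPDF z = gJ1 a := by
  have hd : ∀ z ∈ Ici a, HasDerivAt (fun z => -gaussPDF z + a * gQ z) ((z - a) ^ 1 * gaussPDF z) z := by
    intro z _
    exact (((gp_deriv z).neg).add ((gQ_deriv z).const_mul a)).congr_deriv (by ring)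
  have ht : Tendsto (fun z => -gaussPDF z + a * gQ z) atTop (𝓝 0) := by
    have h0 := gp_pow_tendsto 0
    simp only [pow_zero, one_mul] at h0
    simpa using h0.neg.add (gQ_tendsto.const_mul a)
  rw [integral_Ioi_of_hasDerivAt_of_tendsto' hd (gJ_int a 1).integrableOn ht]
  unfold gJ1; ring

lemma gJ2_eq (a : ℝ) : ∫ z in Ioi a, (z - a) ^ 2 * gaussPDF z = gJ2 a := by
  have hd : ∀ z ∈ Ici a, HasDerivAt (fun z => -(z ^ 1 * gaussPDF z) + 2 * a * gaussPDF z
      - (1 + a ^ 2) * gQ z) ((z - a) ^ 2 * gaussPDF z) z := by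
    intro z _
    refine (((((hasDerivAt_pow 1 z).mul (gp_deriv z)).neg).add ((gp_deriv z).const_mul (2 * a))).sub
      ((gQ_deriv z).const_mul (1 + a ^ 2))).congr_deriv ?_
    simp
    ring
  have ht : Tendsto (fun z => -(z ^ 1 * gaussPDF z) + 2 * a * gaussPDF z
      - (1 + a ^ 2) * gQ z) atTop (𝓝 0) := by
    have h0 := gp_pow_tendsto 0
    simp only [pow_zero, one_mul] at h0
    simpa using ((gp_pow_tendsto 1).neg.add (h0.const_mul (2 * a))).sub (gQ_tendsto.const_mul (1 + a^2))
  rw [integral_Ioi_of_hasDerivAt_of_tendsto' hd (gJ_int a 2).integrableOn ht]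
  unfold gJ2; ring

lemma gJ3_eq (a : ℝ) : ∫ z in Ioi a, (z - a) ^ 3 * gaussPDF z = 2 * gJ1 a - a * gJ2 a := by
  have hd : ∀ z ∈ Ici a, HasDerivAt (fun z => -(z ^ 2 * gaussPDF z) + 3 * a * (z ^ 1 * gaussPDF z)
      - (2 + 3 * a ^ 2) * gaussPDF z + (3 * a + a ^ 3) * gQ z) ((z - a) ^ 3 * gaussPDF z) z := by
    intro z _
    refine (((((hasDerivAt_pow 2 z).mul (gp_deriv z)).neg.add
      (((hasDerivAt_pow 1 z).mul (gp_deriv z)).const_mul (3 * a))).sub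
        ((gp_deriv z).const_mul (2 + 3 * a ^ 2))).add
      ((gQ_deriv z).const_mul (3 * a + a ^ 3))).congr_deriv ?_
    simp
    ring
  have ht : Tendsto (fun z => -(z ^ 2 * gaussPDF z) + 3 * a * (z ^ 1 * gaussPDF z)
      - (2 + 3 * a ^ 2) * gaussPDF z + (3 * a + a ^ 3) * gQ z) atTop (𝓝 0) := by
    have h0 := gp_pow_tendsto 0
    simp only [pow_zero, one_mul] at h0
    simpa using (((gp_pow_tendsto 2).neg.add ((gp_pow_tendsto 1).const_mul (3 * a))).sub
      (h0.const_mul (2 + 3 * a ^ 2))).add (gQ_tendsto.const_mul (3 * a + a^3))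
  rw [integral_Ioi_of_hasDerivAt_of_tendsto' hd (gJ_int a 3).integrableOn ht]
  unfold gJ2 gJ1; ring

lemma gJ_nonneg (a : ℝ) (k : ℕ) : 0 ≤ ∫ z in Ioi a, (z - a) ^ k * gaussPDF z :=
  setIntegral_nonneg measurableSet_Ioi fun z hz =>
    mul_nonneg (pow_nonneg (sub_nonneg.2 (le_of_lt hz)) _) (gp_pos z).le

lemma gJ2_nonneg (a : ℝ) : 0 ≤ gJ2 a := gJ2_eq a ▸ gJ_nonneg a 2
lemma gJ3_nonneg (a : ℝ) : a * gJ2 a ≤ 2 * gJ1 a := by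
  have := gJ_nonneg a 3
  rw [gJ3_eq] at this; linarith

lemma gJ1_nonneg (a : ℝ) : 0 ≤ gJ1 a := gJ1_eq a ▸ gJ_nonneg a 1

lemma gQ_strictAnti : StrictAnti gQ :=
  strictAnti_of_deriv_neg (fun a => by rw [(gQ_deriv a).deriv]; linarith [gp_pos a])

lemma gQ_pos (a : ℝ) : 0 < gQ a := (gQ_nonneg (a+1)).trans_lt (gQ_strictAnti (by linarith))

lemma gJ1_strictAnti : StrictAnti gJ1 :=
  strictAnti_of_deriv_neg (fun a => by rw [(gJ1_deriv a).deriv]; linarith [gQ_pos a])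

lemma gJ1_pos (a : ℝ) : 0 < gJ1 a := (gJ1_nonneg (a+1)).trans_lt (gJ1_strictAnti (by linarith))

lemma gJ2_strictAnti : StrictAnti gJ2 :=
  strictAnti_of_deriv_neg (fun a => by rw [(gJ2_deriv a).deriv]; linarith [gJ1_pos a])

lemma gJ1_tendsto : Tendsto gJ1 atTop (𝓝 0) := by
  have h0 := gp_pow_tendsto 0
  simp only [pow_zero, one_mul] at h0
  refine tendsto_of_tendsto_of_tendsto_of_le_of_le' tendsto_const_nhds h0
    (Eventually.of_forall gJ1_nonneg) ?_
  filter_upwards [eventually_ge_atTop 0] with a ha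
  have := mul_nonneg ha (gQ_nonneg a)
  unfold gJ1; linarith

lemma gJ2_tendsto : Tendsto gJ2 atTop (𝓝 0) := by
  have h0 := gJ1_tendsto.const_mul 2
  rw [mul_zero] at h0
  refine tendsto_of_tendsto_of_tendsto_of_le_of_le' tendsto_const_nhds h0
    (Eventually.of_forall gJ2_nonneg) ?_
  filter_upwards [eventually_ge_atTop 1] with a ha
  have := gJ3_nonneg a
  nlinarith [gJ2_nonneg a]

lemma key_convex (t m : ℝ) : gaussPDF (t - m) * (gQ t + m * gJ1 t) ≤ gaussPDF t * gQ (t - m) := by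
  have h1 : gQ (t - m) = ∫ z in Ioi t, gaussPDF (z - m) := by
    unfold gQ
    rw [← integral_indicator measurableSet_Ioi, ← integral_indicator measurableSet_Ioi,
      ← integral_sub_right_eq_self _ m]
    congr 1
    funext z
    simp [indicator]
  have hi := (gJ_int t 1)
  have h2 : gaussPDF (t - m) * (gQ t + m * gJ1 t) =
      ∫ z in Ioi t, gaussPDF (t - m) * (gaussPDF z + m * ((z - t) ^ 1 * gaussPDF z)) := by
    rw [integral_const_mul, integral_add gp_int.integrableOn (hi.const_mul m).integrableOn,
      integral_const_mul, gJ1_eq]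
    rfl
  rw [h1, h2, ← integral_const_mul]
  refine setIntegral_mono_on (((gp_int.add (hi.const_mul m)).const_mul _).integrableOn)
    (((gp_int.comp_sub_right m).const_mul _).integrableOn) measurableSet_Ioi ?_
  intro z _
  have e : gaussPDF t * gaussPDF (z - m) = gaussPDF (t - m) * gaussPDF z * Real.exp (m * (z - t)) := by
    unfold gaussPDF
    have : Real.exp (-t ^ 2 / 2) * Real.exp (-(z - m) ^ 2 / 2) =
      Real.exp (-(t - m) ^ 2 / 2) * Real.exp (-z ^ 2 / 2) * Real.exp (m * (z - t)) := by
      simp only [← Real.exp_add]; congr 1; ring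
    rw [div_mul_div_comm, this]
    ring
  rw [e]
  have h3 := Real.add_one_le_exp (m * (z - t))
  have h4 := mul_le_mul_of_nonneg_left h3 (mul_pos (gp_pos (t - m)) (gp_pos z)).le
  calc _ = gaussPDF (t - m) * gaussPDF z * (m * (z - t) + 1) := by ring
    _ ≤ _ := h4

noncomputable def rr (m t : ℝ) : ℝ :=
  m ^ 2 + gJ2 (t - m) - 2 * m * gJ1 (t - m) + gJ2 (t + m) + 2 * m * gJ1 (t + m)

lemma max_fun (a : ℝ) (k : ℕ) (hk : k ≠ 0) : (fun z => (max (z - a) 0) ^ k * gaussPDF z) =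
    (Ioi a).indicator (fun z => (z - a) ^ k * gaussPDF z) := by
  funext z
  by_cases h : z ∈ Ioi a
  · rw [indicator_of_mem h, max_eq_left (sub_nonneg.2 (le_of_lt h))]
  · rw [indicator_of_notMem h, max_eq_right (sub_nonpos.2 (not_lt.1 h)), zero_pow hk, zero_mul]

lemma max_int (a : ℝ) (k : ℕ) (hk : k ≠ 0) :
    Integrable (fun z => (max (z - a) 0) ^ k * gaussPDF z) := by
  rw [max_fun a k hk]
  exact (gJ_int a k).indicator measurableSet_Ioi

lemma max_integral (a : ℝ) (k : ℕ) (hk : k ≠ 0) :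
    ∫ z, (max (z - a) 0) ^ k * gaussPDF z = ∫ z in Ioi a, (z - a) ^ k * gaussPDF z := by
  rw [max_fun a k hk, integral_indicator measurableSet_Ioi]

lemma max_int' (a : ℝ) (k : ℕ) (hk : k ≠ 0) :
    Integrable (fun z => (max (-z - a) 0) ^ k * gaussPDF z) := by
  have := (max_int a k hk).comp_neg
  simpa only [gp_neg] using this

lemma max_integral' (a : ℝ) (k : ℕ) (hk : k ≠ 0) :
    ∫ z, (max (-z - a) 0) ^ k * gaussPDF z = ∫ z in Ioi a, (z - a) ^ k * gaussPDF z := by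
  rw [← max_integral a k hk, ← integral_neg_eq_self (fun z => (max (z - a) 0) ^ k * gaussPDF z)]
  simp only [gp_neg]

lemma softThr_eq (y t : ℝ) (ht : 0 < t) : softThr y t = max (y - t) 0 - max (-y - t) 0 := by
  unfold softThr
  rcases lt_trichotomy y 0 with h | h | h
  · rw [Real.sign_of_neg h, abs_of_neg h, max_eq_right (a := y - t) (by linarith)]; ring
  · subst h; simp
  · rw [Real.sign_of_pos h, abs_of_pos h, max_eq_right (a := -y - t) (by linarith)]; ring

lemma max_mul_aux (y t : ℝ) (ht : 0 < t) : max (y - t) 0 * max (-y - t) 0 = 0 := by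
  rcases le_total y 0 with h | h
  · rw [max_eq_right (a := y - t) (by linarith)]; ring
  · rw [max_eq_right (a := -y - t) (by linarith)]; ring

lemma risk_eq (m t : ℝ) (ht : 0 < t) :
    ∫ z, (softThr (m + z) t - m) ^ 2 * gaussPDF z = rr m t := by
  have e : (fun z => (softThr (m + z) t - m) ^ 2 * gaussPDF z) = fun z =>
      m ^ 2 * gaussPDF z + (max (z - (t - m)) 0) ^ 2 * gaussPDF z
      + (- 2 * m) * ((max (z - (t - m)) 0) ^ 1 * gaussPDF z)
      + (max (-z - (t + m)) 0) ^ 2 * gaussPDF z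
      + (2 * m) * ((max (-z - (t + m)) 0) ^ 1 * gaussPDF z) := by
    funext z
    rw [softThr_eq _ _ ht]
    have h := max_mul_aux (m + z) t ht
    rw [show z - (t - m) = m + z - t by ring, show -z - (t + m) = -(m + z) - t by ring]
    linear_combination (-2 * gaussPDF z) * h
  have i0 := gp_int.const_mul (m ^ 2)
  have i1 := max_int (t - m) 2 two_ne_zero
  have i2 := (max_int (t - m) 1 one_ne_zero).const_mul (-2 * m)
  have i3 := max_int' (t + m) 2 two_ne_zero
  have i4 := (max_int' (t + m) 1 one_ne_zero).const_mul (2 * m)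
  rw [e, integral_add (((i0.fun_add i1).fun_add i2).fun_add i3) i4, integral_add ((i0.fun_add i1).fun_add i2) i3,
    integral_add (i0.fun_add i1) i2, integral_add i0 i1, integral_const_mul, integral_const_mul,
    integral_const_mul, gp_one, max_integral _ _ two_ne_zero, max_integral _ _ one_ne_zero,
    max_integral' _ _ two_ne_zero, max_integral' _ _ one_ne_zero, gJ2_eq, gJ2_eq, gJ1_eq, gJ1_eq]
  unfold rr; ring

lemma rr_nonneg (m t : ℝ) (ht : 0 < t) : 0 ≤ rr m t := by
  rw [← risk_eq m t ht]
  exact integral_nonneg fun z => mul_nonneg (sq_nonneg _) (gp_pos z).le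

lemma rr_neg (m t : ℝ) : rr (-m) t = rr m t := by
  unfold rr
  rw [sub_neg_eq_add, ← sub_eq_add_neg]; ring

lemma rr_abs (m t : ℝ) : rr |m| t = rr m t := by
  rcases abs_choice m with h | h <;> rw [h]
  exact rr_neg m t

lemma gJ1_cont : Continuous gJ1 :=
  continuous_iff_continuousAt.2 fun a => (gJ1_deriv a).continuousAt
lemma gJ2_cont : Continuous gJ2 :=
  continuous_iff_continuousAt.2 fun a => (gJ2_deriv a).continuousAt

lemma rr_cont_m (t : ℝ) : Continuous fun m => rr m t := by
  unfold rr
  have := gJ1_cont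
  have := gJ2_cont
  fun_prop

lemma rr_cont_t (m : ℝ) : Continuous fun t => rr m t := by
  unfold rr
  have := gJ1_cont
  have := gJ2_cont
  fun_prop

lemma rr_deriv_m (m t : ℝ) :
    HasDerivAt (fun m => rr m t) (2 * m * (1 - gQ (t - m) - gQ (t + m))) m := by
  have a1 : HasDerivAt (fun m => t - m) (-1) m := (hasDerivAt_id m).const_sub t
  have a2 : HasDerivAt (fun m => t + m) 1 m := (hasDerivAt_id m).const_add t
  have b1 := (gJ2_deriv (t - m)).comp m a1
  have b2 := (gJ1_deriv (t - m)).comp m a1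
  have b3 := (gJ2_deriv (t + m)).comp m a2
  have b4 := (gJ1_deriv (t + m)).comp m a2
  have c := (hasDerivAt_id m).const_mul 2
  have := ((((hasDerivAt_pow 2 m).add b1).sub (c.mul b2)).add b3).add (c.mul b4)
  refine this.congr_deriv ?_
  simp
  ring

lemma rr_mono (t : ℝ) (ht : 0 < t) : MonotoneOn (fun m => rr m t) (Ici 0) := by
  refine monotoneOn_of_deriv_nonneg (convex_Ici 0) (rr_cont_m t).continuousOn
    (fun m _ => (rr_deriv_m m t).differentiableAt.differentiableWithinAt) ?_
  intro m hm
  rw [interior_Ici] at hm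
  have hm : 0 < m := hm
  rw [(rr_deriv_m m t).deriv]
  have h1 := gQ_add (t - m)
  have h2 : gQ (t + m) ≤ gQ (-(t - m)) := gQ_anti (by linarith)
  exact mul_nonneg (by linarith) (by linarith)

lemma dd_anti (t : ℝ) : AntitoneOn (fun m => rr m t - m ^ 2) (Ici 0) := by
  have hd : ∀ m, HasDerivAt (fun m => rr m t - m ^ 2) (-(2 * m * (gQ (t - m) + gQ (t + m)))) m := by
    intro m
    refine ((rr_deriv_m m t).sub (hasDerivAt_pow 2 m)).congr_deriv ?_
    simp
    ring
  refine antitoneOn_of_deriv_nonpos (convex_Ici 0)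
    (fun m _ => (hd m).continuousAt.continuousWithinAt)
    (fun m _ => (hd m).differentiableAt.differentiableWithinAt) ?_
  intro m hm
  rw [interior_Ici] at hm
  have hm : 0 < m := hm
  rw [(hd m).deriv]
  have := gQ_pos (t - m)
  have := gQ_pos (t + m)
  have : 0 < 2 * m * (gQ (t - m) + gQ (t + m)) := by positivity
  linarith

lemma rr_mono_abs {m n t : ℝ} (ht : 0 < t) (h : |m| ≤ |n|) : rr m t ≤ rr n t := by
  rw [← rr_abs m, ← rr_abs n]
  exact rr_mono t ht (abs_nonneg m) (abs_nonneg n) h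

lemma dd_anti_abs {m n : ℝ} (t : ℝ) (h : |m| ≤ |n|) : rr n t - n ^ 2 ≤ rr m t - m ^ 2 := by
  rw [← rr_abs m, ← rr_abs n, ← sq_abs m, ← sq_abs n]
  exact dd_anti t (abs_nonneg m) (abs_nonneg n) h

lemma rr_zero_left (t : ℝ) : rr 0 t = 2 * gJ2 t := by unfold rr; simp; ring

lemma rr_zero_right (m : ℝ) : rr m 0 = 1 := by
  unfold rr gJ2 gJ1
  have := gQ_add m
  simp only [zero_sub, zero_add, gp_neg]
  linear_combination (1 - m ^ 2) * this

lemma rr_le (m t : ℝ) (ht : 0 ≤ t) : rr m t ≤ m ^ 2 + 1 := by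
  have h := dd_anti_abs (m := 0) (n := m) t (by simp)
  rw [rr_zero_left] at h
  have h2 := gJ2_strictAnti.antitone ht
  have h3 := rr_zero_left 0
  rw [rr_zero_right] at h3
  linarith

lemma rr_tendsto (m : ℝ) : Tendsto (fun t => rr m t) atTop (𝓝 (m ^ 2)) := by
  have a1 : Tendsto (fun t : ℝ => t - m) atTop atTop := tendsto_atTop_add_const_right _ (-m) tendsto_id
  have a2 : Tendsto (fun t : ℝ => t + m) atTop atTop := tendsto_atTop_add_const_right _ m tendsto_id
  have := ((((gJ2_tendsto.comp a1).const_add (m ^ 2)).sub ((gJ1_tendsto.comp a1).const_mul (2 * m))).add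
    (gJ2_tendsto.comp a2)).add ((gJ1_tendsto.comp a2).const_mul (2 * m))
  simpa [rr, Function.comp_def] using this

noncomputable def hh (m t : ℝ) : ℝ :=
  t * (gQ (t - m) + gQ (t + m)) - gaussPDF (t - m) - gaussPDF (t + m)

lemma rr_deriv_t (m t : ℝ) : HasDerivAt (fun t => rr m t) (2 * hh m t) t := by
  have a1 : HasDerivAt (fun t => t - m) 1 t := (hasDerivAt_id t).sub_const m
  have a2 : HasDerivAt (fun t => t + m) 1 t := (hasDerivAt_id t).add_const m
  have b1 := (gJ2_deriv (t - m)).comp t a1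
  have b2 := (gJ1_deriv (t - m)).comp t a1
  have b3 := (gJ2_deriv (t + m)).comp t a2
  have b4 := (gJ1_deriv (t + m)).comp t a2
  have := (((b1.const_add (m ^ 2)).sub (b2.const_mul (2 * m))).add b3).add (b4.const_mul (2 * m))
  refine this.congr_deriv ?_
  unfold hh gJ1
  ring

lemma hh_deriv (m t : ℝ) : HasDerivAt (fun t => hh m t)
    (gQ (t - m) + gQ (t + m) - m * (gaussPDF (t - m) - gaussPDF (t + m))) t := by
  have a1 : HasDerivAt (fun t => t - m) 1 t := (hasDerivAt_id t).sub_const m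
  have a2 : HasDerivAt (fun t => t + m) 1 t := (hasDerivAt_id t).add_const m
  have b1 := (gQ_deriv (t - m)).comp t a1
  have b2 := (gp_deriv (t - m)).comp t a1
  have b3 := (gQ_deriv (t + m)).comp t a2
  have b4 := (gp_deriv (t + m)).comp t a2
  have := (((hasDerivAt_id t).mul (b1.add b3)).sub b2).sub b4
  refine this.congr_deriv ?_
  simp
  ring

lemma W_mono (m : ℝ) : Monotone fun t => hh m t / gJ1 t := by
  have hd := fun t => (hh_deriv m t).div (gJ1_deriv t) (gJ1_pos t).ne'
  refine monotone_of_deriv_nonneg (fun t => (hd t).differentiableAt) fun t => ?_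
  have := (hd t).deriv
  refine le_of_le_of_eq ?_ this.symm
  refine div_nonneg ?_ (sq_nonneg _)
  have k1 := key_convex t m
  have k2 := key_convex t (-m)
  rw [sub_neg_eq_add] at k2
  have e : gaussPDF t = gJ1 t + t * gQ t := by unfold gJ1; ring
  rw [e] at k1 k2
  unfold hh
  linarith

lemma rr_convex {m a b c : ℝ} (hab : a < b) (hbc : b < c) :
    (rr m b - rr m a) * (gJ2 b - gJ2 c) ≤ (rr m c - rr m b) * (gJ2 a - gJ2 b) := by
  have cm : ∀ a b, a < b → ∃ x ∈ Ioo a b, (gJ2 a - gJ2 b) * (hh m x / gJ1 x) = rr m b - rr m a := by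
    intro a b hab
    obtain ⟨x, hx, h⟩ := exists_ratio_hasDerivAt_eq_ratio_slope gJ2 (fun x => -2 * gJ1 x) hab
      gJ2_cont.continuousOn (fun x _ => gJ2_deriv x) (fun t => rr m t) (fun t => 2 * hh m t)
      (rr_cont_t m).continuousOn (fun x _ => rr_deriv_t m x)
    refine ⟨x, hx, ?_⟩
    have := gJ1_pos x
    field_simp
    linarith
  obtain ⟨x, hx, h1⟩ := cm a b hab
  obtain ⟨y, hy, h2⟩ := cm b c hbc
  have hw : hh m x / gJ1 x ≤ hh m y / gJ1 y := W_mono m (hx.2.trans hy.1).le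
  rw [← h1, ← h2]
  have p1 : 0 < gJ2 a - gJ2 b := sub_pos.2 (gJ2_strictAnti hab)
  have p2 : 0 < gJ2 b - gJ2 c := sub_pos.2 (gJ2_strictAnti hbc)
  have := mul_le_mul_of_nonneg_left hw (mul_pos p1 p2).le
  linarith

/-- for large `t`, `d_0 + p d_e < 0` -/
lemma exists_neg (p e : ℝ) (hp : 0 < p) (he : 0 < e) :
    ∃ t, 0 < t ∧ rr 0 t + p * (rr e t - e ^ 2) < 0 := by
  set t := e + 2 / e + (2 + 3 * p) / (p * e) with htd
  have q1 : 0 < 2 / e := by positivity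
  have q2 : 0 < (2 + 3 * p) / (p * e) := by positivity
  have ht : 0 < t := by positivity
  refine ⟨t, ht, ?_⟩
  have hJ : ∀ x, 2 / e ≤ x → gJ2 x ≤ e * gJ1 x := by
    intro x hx
    have h3 := gJ3_nonneg x
    have h4 : (2 / e) * gJ2 x ≤ 2 * gJ1 x :=
      (mul_le_mul_of_nonneg_right hx (gJ2_nonneg x)).trans h3
    have h5 := mul_le_mul_of_nonneg_left h4 he.le
    have h6 : e * (2 / e * gJ2 x) = 2 * gJ2 x := by field_simp
    linarith
  have j1 := hJ (t - e) (by rw [htd]; linarith)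
  have j2 := hJ (t + e) (by rw [htd]; linarith)
  have j3 := hJ t (by rw [htd]; linarith)
  have j4 : gJ1 (t + e) ≤ gJ1 t := gJ1_strictAnti.antitone (by linarith)
  obtain ⟨x, hx, h⟩ := exists_hasDerivAt_eq_slope gJ1 (fun x => -gQ x) (show t - e < t by linarith)
    gJ1_cont.continuousOn (fun x _ => gJ1_deriv x)
  have h' : gJ1 (t - e) - gJ1 t = e * gQ x := by
    rw [show t - (t - e) = e by ring, eq_div_iff he.ne'] at h
    linarith
  have h7 : t * gJ1 t ≤ gQ x := by
    have a1 := gQ_anti hx.2.le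
    have a2 := gJ2_nonneg t
    unfold gJ2 at a2
    unfold gJ1
    linarith
  have h8 := mul_le_mul_of_nonneg_left h7 he.le
  have h9 : 2 + 3 * p ≤ p * (e * t) := by
    have : (2 + 3 * p) / (p * e) ≤ t := by rw [htd]; linarith
    rw [div_le_iff₀ (by positivity)] at this
    linarith
  have hpos := gJ1_pos t
  rw [rr_zero_left]
  unfold rr
  have b1 : e ^ 2 + gJ2 (t - e) - 2 * e * gJ1 (t - e) + gJ2 (t + e) + 2 * e * gJ1 (t + e) - e ^ 2
      ≤ e * (3 * gJ1 t - gJ1 (t - e)) := by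
    nlinarith
  have b2 : 3 * gJ1 t - gJ1 (t - e) ≤ 2 * gJ1 t - e * t * gJ1 t := by linarith
  have b3 := mul_le_mul_of_nonneg_left (b1.trans (mul_le_mul_of_nonneg_left b2 he.le)) hp.le
  have b4 : (2 + 3 * p) * (e * gJ1 t) ≤ p * (e * t) * (e * gJ1 t) :=
    mul_le_mul_of_nonneg_right h9 (by positivity)
  have b5 : 0 < p * (e * gJ1 t) := by positivity
  linarith

noncomputable def RR (G : Measure ℝ) (s t : ℝ) : ℝ := ∫ x, rr (x / s) t ∂G

section
variable {G : Measure ℝ} [IsProbabilityMeasure G]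

lemma bd_int (hX : Integrable (fun x => x ^ 2) G) (s : ℝ) :
    Integrable (fun x => (x / s) ^ 2 + 1) G := by
  have := (hX.div_const (s ^ 2)).add (integrable_const (1:ℝ))
  refine this.congr (ae_of_all _ fun x => ?_)
  simp [div_pow]

lemma sq_int (hX : Integrable (fun x => x ^ 2) G) (s : ℝ) :
    Integrable (fun x => (x / s) ^ 2) G := by
  simpa [div_pow] using (hX.div_const (s ^ 2))

lemma rr_meas (s t : ℝ) : AEStronglyMeasurable (fun x => rr (x / s) t) G :=
  ((rr_cont_m t).comp (continuous_id.div_const s)).aestronglyMeasurable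

lemma rr_int (hX : Integrable (fun x => x ^ 2) G) (s t : ℝ) (ht : 0 < t) :
    Integrable (fun x => rr (x / s) t) G := by
  refine (bd_int hX s).mono' (rr_meas s t) (ae_of_all _ fun x => ?_)
  rw [Real.norm_of_nonneg (rr_nonneg _ _ ht)]
  exact rr_le _ _ ht.le

lemma RR_anti (hX : Integrable (fun x => x ^ 2) G) {s s' t : ℝ} (ht : 0 < t) (hs : 0 < s)
    (h : s ≤ s') : RR G s' t ≤ RR G s t := by
  refine integral_mono (rr_int hX s' t ht) (rr_int hX s t ht) fun x => ?_
  refine rr_mono_abs ht ?_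
  rw [abs_div, abs_div, abs_of_pos hs, abs_of_pos (hs.trans_le h)]
  exact div_le_div_of_nonneg_left (abs_nonneg x) hs h

lemma RR_quasi (hX : Integrable (fun x => x ^ 2) G) (s : ℝ) {a b c : ℝ} (ha : 0 < a)
    (hab : a < b) (hbc : b < c) : RR G s b ≤ max (RR G s a) (RR G s c) := by
  have ia := rr_int hX s a ha
  have ib := rr_int hX s b (ha.trans hab)
  have ic := rr_int hX s c (ha.trans (hab.trans hbc))
  have p1 : 0 < gJ2 a - gJ2 b := sub_pos.2 (gJ2_strictAnti hab)
  have p2 : 0 < gJ2 b - gJ2 c := sub_pos.2 (gJ2_strictAnti hbc)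
  have key : (RR G s b - RR G s a) * (gJ2 b - gJ2 c) ≤ (RR G s c - RR G s b) * (gJ2 a - gJ2 b) := by
    unfold RR
    rw [← integral_sub ib ia, ← integral_sub ic ib, ← integral_mul_const, ← integral_mul_const]
    exact integral_mono ((ib.sub ia).mul_const _) ((ic.sub ib).mul_const _)
      fun x => rr_convex hab hbc
  by_contra! hcon
  rw [max_lt_iff] at hcon
  have := mul_pos (sub_pos.2 hcon.1) p2
  have := mul_pos (sub_pos.2 hcon.2) p1
  linarith

lemma RR_zero (hX : Integrable (fun x => x ^ 2) G) (s : ℝ) :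
    Tendsto (fun t => RR G s t) (𝓝[>] 0) (𝓝 1) := by
  have h1 : (1:ℝ) = ∫ _x, (1:ℝ) ∂G := by simp
  rw [h1]
  refine tendsto_integral_filter_of_dominated_convergence (fun x => (x / s) ^ 2 + 1)
    (Eventually.of_forall fun t => rr_meas s t) ?_ (bd_int hX s) (ae_of_all _ fun x => ?_)
  · filter_upwards [self_mem_nhdsWithin] with t ht
    refine ae_of_all _ fun x => ?_
    rw [Real.norm_of_nonneg (rr_nonneg _ _ ht)]
    exact rr_le _ _ (le_of_lt ht)
  · have := ((rr_cont_t (x / s)).tendsto 0).mono_left (nhdsWithin_le_nhds (s := Ioi 0))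
    rwa [rr_zero_right] at this

lemma RR_top (hX : Integrable (fun x => x ^ 2) G) (s : ℝ) :
    Tendsto (fun t => RR G s t) atTop (𝓝 (∫ x, (x / s) ^ 2 ∂G)) := by
  refine tendsto_integral_filter_of_dominated_convergence (fun x => (x / s) ^ 2 + 1)
    (Eventually.of_forall fun t => rr_meas s t) ?_ (bd_int hX s)
    (ae_of_all _ fun x => rr_tendsto (x / s))
  filter_upwards [eventually_gt_atTop 0] with t ht
  refine ae_of_all _ fun x => ?_
  rw [Real.norm_of_nonneg (rr_nonneg _ _ ht)]
  exact rr_le _ _ (le_of_lt ht)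

lemma exists_eps (h : 0 < G {x : ℝ | x ≠ 0}) : ∃ e : ℝ, 0 < e ∧ 0 < G {x : ℝ | e ≤ |x|} := by
  by_contra! hcon
  have : {x : ℝ | x ≠ 0} ⊆ ⋃ n : ℕ, {x : ℝ | 1 / ((n:ℝ) + 1) ≤ |x|} := by
    intro x hx
    obtain ⟨n, hn⟩ := exists_nat_one_div_lt (abs_pos.2 hx)
    exact mem_iUnion.2 ⟨n, hn.le⟩
  have h0 : G (⋃ n : ℕ, {x : ℝ | 1 / ((n:ℝ) + 1) ≤ |x|}) = 0 :=
    measure_iUnion_null fun n => le_antisymm (hcon _ (by positivity)) zero_le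
  exact h.ne' (measure_mono_null this h0)

lemma RR_lt (hX : Integrable (fun x => x ^ 2) G) {s : ℝ} (hs : 0 < s) (h : 0 < G {x : ℝ | x ≠ 0}) :
    ∃ t, 0 < t ∧ RR G s t < ∫ x, (x / s) ^ 2 ∂G := by
  obtain ⟨e, he, hG⟩ := exists_eps h
  set A := {x : ℝ | e ≤ |x|} with hA
  have mA : MeasurableSet A := measurableSet_le measurable_const continuous_abs.measurable
  have hp : 0 < G.real A := ENNReal.toReal_pos hG.ne' (measure_ne_top _ _)
  obtain ⟨t, ht, hneg⟩ := exists_neg (G.real A) (e / s) hp (by positivity)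
  refine ⟨t, ht, ?_⟩
  have i1 := rr_int hX s t ht
  have i2 := sq_int hX s
  have i3 : Integrable (A.indicator fun _ => rr (e / s) t - (e / s) ^ 2) G :=
    (integrable_const _).indicator mA
  have hle : ∫ x, (rr (x / s) t - (x / s) ^ 2) ∂G ≤
      ∫ x, (rr 0 t + A.indicator (fun _ => rr (e / s) t - (e / s) ^ 2) x) ∂G := by
    refine integral_mono (i1.sub i2) ((integrable_const _).add i3) fun x => ?_
    by_cases hx : x ∈ A
    · simp only [indicator_of_mem hx]
      have h1 : rr (x / s) t - (x / s) ^ 2 ≤ rr (e / s) t - (e / s) ^ 2 := by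
        refine dd_anti_abs t ?_
        rw [abs_div, abs_div, abs_of_pos he]
        exact div_le_div_of_nonneg_right hx (abs_nonneg s)
      have h2 := rr_nonneg 0 t ht
      linarith
    · simp only [indicator_of_notMem hx]
      have := dd_anti_abs (m := 0) (n := x / s) t (by simp)
      linarith
  rw [integral_sub i1 i2, integral_add (integrable_const _) i3, integral_indicator mA] at hle
  simp only [integral_const, probReal_univ, smul_eq_mul, one_mul, measureReal_restrict_apply_univ] at hle
  unfold RR
  linarith
end

lemma scale_eq (x s b z : ℝ) (hs : 0 < s) (hb : 0 < b) :
    softThr (x + s * z) (b * s) - x = s * (softThr (x / s + z) b - x / s) := by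
  rw [softThr_eq _ _ (by positivity), softThr_eq _ _ hb, mul_sub, mul_sub, mul_max_of_nonneg _ _ hs.le,
    mul_max_of_nonneg _ _ hs.le]
  have : s * (x / s) = x := by field_simp
  congr 3
  · rw [mul_sub, mul_add, this]; ring
  · ring
  · rw [mul_sub, mul_neg, mul_add, this]; ring
  · ring
  · exact this.symm

lemma fix_eq (G : Measure ℝ) (s b : ℝ) (hs : 0 < s) (hb : 0 < b) :
    ∫ x, (∫ z, (softThr (x + s * z) (b * s) - x) ^ 2 * gaussPDF z) ∂G = s ^ 2 * RR G s b := by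
  unfold RR
  rw [← integral_const_mul]
  congr 1
  funext x
  rw [← risk_eq _ _ hb, ← integral_const_mul]
  congr 1
  funext z
  rw [scale_eq x s b z hs hb]; ring

/-- under the state-evolution fixed-point setup, `β ↦ σ(β)²` is quasi-convex
on `(0, ∞)`, hence so is the asymptotic MSE `β ↦ E[(η(X + σ(β)Z; βσ(β)) − X)²]
= δ·(σ(β)² − σ_w²)`; moreover if `P(X ≠ 0) > 0` then `β ↦ σ(β)²` attains a global
minimum on `(0, ∞)` (it is bowl-shaped). -/
theorem sigma_sq_quasiconvex (G : Measure ℝ) [IsProbabilityMeasure G]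
    (hX : Integrable (fun x => x ^ 2) G)
    (δ σw : ℝ) (hδ : 0 < δ) (hδ1 : δ ≤ 1) (hσw : 0 < σw)
    (σ : ℝ → ℝ) (hσpos : ∀ β : ℝ, 0 < β → 0 < σ β)
    (hσdiff : ∀ β : ℝ, 0 < β → DifferentiableAt ℝ σ β)
    (hfix : ∀ β : ℝ, 0 < β →
      (σ β) ^ 2 = σw ^ 2 +
        (1 / δ) * ∫ x, (∫ z, (softThr (x + σ β * z) (β * σ β) - x) ^ 2 * gaussPDF z) ∂G) :
    (∀ β₁ β₂ β₃ : ℝ, 0 < β₁ → β₁ < β₂ → β₂ < β₃ →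
      (σ β₂) ^ 2 ≤ max ((σ β₁) ^ 2) ((σ β₃) ^ 2)) ∧
    (∀ β : ℝ, 0 < β →
      (∫ x, (∫ z, (softThr (x + σ β * z) (β * σ β) - x) ^ 2 * gaussPDF z) ∂G) =
        δ * ((σ β) ^ 2 - σw ^ 2)) ∧
    (∀ β₁ β₂ β₃ : ℝ, 0 < β₁ → β₁ < β₂ → β₂ < β₃ →
      (∫ x, (∫ z, (softThr (x + σ β₂ * z) (β₂ * σ β₂) - x) ^ 2 * gaussPDF z) ∂G) ≤
        max (∫ x, (∫ z, (softThr (x + σ β₁ * z) (β₁ * σ β₁) - x) ^ 2 * gaussPDF z) ∂G)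
            (∫ x, (∫ z, (softThr (x + σ β₃ * z) (β₃ * σ β₃) - x) ^ 2 * gaussPDF z) ∂G)) ∧
    (0 < G {x : ℝ | x ≠ 0} →
      ∃ β₀ : ℝ, 0 < β₀ ∧ ∀ β : ℝ, 0 < β → (σ β₀) ^ 2 ≤ (σ β) ^ 2) := by
  have hmse : ∀ β : ℝ, 0 < β →
      (∫ x, (∫ z, (softThr (x + σ β * z) (β * σ β) - x) ^ 2 * gaussPDF z) ∂G) =
        δ * ((σ β) ^ 2 - σw ^ 2) := by
    intro β hβ
    have := hfix β hβ
    rw [this]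
    field_simp
    ring
  have hR : ∀ β, 0 < β → RR G (σ β) β = δ * (1 - σw ^ 2 / (σ β) ^ 2) := by
    intro β hβ
    have h := hmse β hβ
    have hs := hσpos β hβ
    rw [fix_eq G _ _ hs hβ] at h
    field_simp
    linarith
  have hcmp : ∀ s, 0 < s → ∀ t, s < t → δ * (1 - σw ^ 2 / s ^ 2) < δ * (1 - σw ^ 2 / t ^ 2) := by
    intro s hs t hst
    have h2 : s ^ 2 < t ^ 2 := by gcongr
    have : σw ^ 2 / t ^ 2 < σw ^ 2 / s ^ 2 := by gcongr
    exact mul_lt_mul_of_pos_left (by linarith) hδ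
  have hiff : ∀ β, 0 < β → ∀ s, 0 < s → (s < σ β ↔ δ * (1 - σw ^ 2 / s ^ 2) < RR G s β) := by
    intro β hβ s hs
    constructor
    · intro h
      have := RR_anti hX hβ hs h.le
      rw [hR β hβ] at this
      exact (hcmp s hs _ h).trans_le this
    · intro h
      by_contra! hcon
      have h1 := RR_anti hX hβ (hσpos β hβ) hcon
      rw [hR β hβ] at h1
      rcases hcon.lt_or_eq with h2 | h2
      · linarith [hcmp _ (hσpos β hβ) s h2]
      · rw [h2] at h1; linarith
  have hq : ∀ β₁ β₂ β₃ : ℝ, 0 < β₁ → β₁ < β₂ → β₂ < β₃ →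
      (σ β₂) ^ 2 ≤ max ((σ β₁) ^ 2) ((σ β₃) ^ 2) := by
    intro b1 b2 b3 h1 h12 h23
    have h2 := h1.trans h12
    have h3 := h2.trans h23
    set s := max (σ b1) (σ b3) with hs
    have hs0 : 0 < s := (hσpos b1 h1).trans_le (le_max_left _ _)
    have k1 := (not_congr (hiff b1 h1 s hs0)).1 (not_lt.2 (le_max_left _ _))
    have k3 := (not_congr (hiff b3 h3 s hs0)).1 (not_lt.2 (le_max_right _ _))
    have k2 : ¬ δ * (1 - σw ^ 2 / s ^ 2) < RR G s b2 :=
      not_lt.2 ((RR_quasi hX s h1 h12 h23).trans (max_le (not_lt.1 k1) (not_lt.1 k3)))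
    have k : σ b2 ≤ s := not_lt.1 ((not_congr (hiff b2 h2 s hs0)).2 k2)
    rcases le_max_iff.1 k with k | k
    · exact le_max_of_le_left (pow_le_pow_left₀ (hσpos b2 h2).le k 2)
    · exact le_max_of_le_right (pow_le_pow_left₀ (hσpos b2 h2).le k 2)
  refine ⟨hq, hmse, ?_, ?_⟩
  · intro b1 b2 b3 h1 h12 h23
    have h2 := h1.trans h12
    have h3 := h2.trans h23
    rw [hmse b1 h1, hmse b2 h2, hmse b3 h3]
    rcases le_max_iff.1 (hq b1 b2 b3 h1 h12 h23) with k | k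
    · exact le_max_of_le_left (mul_le_mul_of_nonneg_left (by linarith) hδ.le)
    · exact le_max_of_le_right (mul_le_mul_of_nonneg_left (by linarith) hδ.le)
  · intro hne
    set M := ∫ x, x ^ 2 ∂G with hM
    have hM0 : 0 ≤ M := integral_nonneg fun x => sq_nonneg x
    have hMs : ∀ s : ℝ, ∫ x, (x / s) ^ 2 ∂G = M / s ^ 2 := by
      intro s
      simp only [div_pow]
      rw [integral_div]
    set S := Real.sqrt (σw ^ 2 + M / δ) with hS
    have hpos : 0 < σw ^ 2 + M / δ := by positivity
    have hS0 : 0 < S := Real.sqrt_pos.2 hpos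
    have hS2 : S ^ 2 = σw ^ 2 + M / δ := Real.sq_sqrt hpos.le
    have hMδ : M = δ * (S ^ 2 - σw ^ 2) := by rw [hS2]; field_simp; ring
    obtain ⟨b0, hb0, hlt⟩ := RR_lt hX hS0 hne
    rw [hMs] at hlt
    have hb0S : σ b0 < S := by
      by_contra! hcon
      have h1 : RR G S b0 < δ * (1 - σw ^ 2 / S ^ 2) := by
        refine hlt.trans_eq ?_
        rw [hMδ]; field_simp
      rcases hcon.lt_or_eq with h | h
      · exact lt_asymm h1 ((hiff b0 hb0 S hS0).1 h)
      · rw [h, hR b0 hb0] at h1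
        exact lt_irrefl _ h1
    set s := σ b0 with hs
    have hs0 : 0 < s := hσpos b0 hb0
    have hsS : s ^ 2 < S ^ 2 := by gcongr
    have e0 : ∀ᶠ β in 𝓝[>] (0:ℝ), δ * (1 - σw ^ 2 / s ^ 2) < RR G s β := by
      refine (RR_zero hX s).eventually_const_lt ?_
      have : 0 < σw ^ 2 / s ^ 2 := by positivity
      nlinarith
    have e1 : ∀ᶠ β in atTop, δ * (1 - σw ^ 2 / s ^ 2) < RR G s β := by
      refine (RR_top hX s).eventually_const_lt ?_
      rw [hMs, hMδ, lt_div_iff₀ (by positivity)]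
      have : δ * (1 - σw ^ 2 / s ^ 2) * s ^ 2 = δ * (s ^ 2 - σw ^ 2) := by field_simp
      rw [this]
      exact mul_lt_mul_of_pos_left (by linarith) hδ
    obtain ⟨u, hu, hu'⟩ := mem_nhdsGT_iff_exists_Ioo_subset.1 e0
    obtain ⟨B, hB⟩ := eventually_atTop.1 e1
    have hu : 0 < u := hu
    have hlow : ∀ β, 0 < β → β < u → s < σ β := fun β h1 h2 =>
      (hiff β h1 s hs0).2 (hu' ⟨h1, h2⟩)
    have hhigh : ∀ β, 0 < β → B ≤ β → s < σ β := fun β h1 h2 =>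
      (hiff β h1 s hs0).2 (hB β h2)
    have hub : u ≤ b0 := by
      by_contra! h
      exact lt_irrefl _ (hlow b0 hb0 h)
    have hbB : b0 ≤ B := by
      by_contra! h
      exact lt_irrefl _ (hhigh b0 hb0 h.le)
    obtain ⟨β₀, hβ₀, hmin⟩ := (isCompact_Icc (a := u) (b := B)).exists_isMinOn ⟨b0, hub, hbB⟩
      (f := σ) (fun β hβ => (hσdiff β (hu.trans_le hβ.1)).continuousAt.continuousWithinAt)
    have hβ₀0 : 0 < β₀ := hu.trans_le hβ₀.1
    refine ⟨β₀, hβ₀0, fun β hβ => pow_le_pow_left₀ (hσpos β₀ hβ₀0).le ?_ 2⟩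
    have hm0 : σ β₀ ≤ s := hmin ⟨hub, hbB⟩
    by_cases h1 : β < u
    · exact hm0.trans (hlow β hβ h1).le
    by_cases h2 : B ≤ β
    · exact hm0.trans (hhigh β hβ h2).le
    exact hmin ⟨not_lt.1 h1, (not_le.1 h2).le⟩
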